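/- Let m ∈ ℕ and let J be a set of binary words of length 2m+1 with at least 5 elements, and let α₁ ≺ α₂ ≺ α₃ be three distinct elements of J in lexicographic order. Then there exists f in Thompson's group F such that f · (⋃_{α ∈ J} C_α) = ⋃_{α ∈ J ∖ {α₁, α₂, α₃}} C_α. -/

import Mathlib

open Set MeasureTheory Filter Topology

/-- The binary Cantor space. -/
abbrev CantorC : Type := ℕ → Bool

/-- Finite binary words. -/
abbrev BWord : Type := List Bool

/-- Prepend a finite word to an infinite binary sequence. -/
def wordApp (w : BWord) (x : CantorC) : CantorC := fun n =>
  if h : n < w.length then w.get ⟨n, h⟩ else x (n - w.length)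

/-- The cylinder of sequences beginning with the word `w`. -/
def cyl (w : BWord) : Set CantorC := Set.range (wordApp w)

/-- `J` is a code: both the α-cylinders and the β-cylinders form a partition of the
Cantor space (every point lies in the cylinder of exactly one pair). -/
def IsCode (J : Finset (BWord × BWord)) : Prop :=
  (∀ x : CantorC, ∃! p : BWord × BWord, p ∈ J ∧ x ∈ cyl p.1) ∧
  (∀ x : CantorC, ∃! p : BWord × BWord, p ∈ J ∧ x ∈ cyl p.2)

/-- `J` is order preserving: α ≺ α' lexicographically iff β ≺ β' lexicographically. -/
def OrdPres (J : Finset (BWord × BWord)) : Prop :=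
  ∀ p ∈ J, ∀ q ∈ J, (List.Lex (· < ·) p.1 q.1 ↔ List.Lex (· < ·) p.2 q.2)

/-- The bijection `g` is induced by the code `J` : it maps `β·x` to `α·x`. -/
def InducedBy (J : Finset (BWord × BWord)) (g : Equiv.Perm CantorC) : Prop :=
  ∀ p ∈ J, ∀ x : CantorC, g (wordApp p.2 x) = wordApp p.1 x

/-- `J` is an order-preserving code inducing the bijection `g`. -/
def IsCodeFor (J : Finset (BWord × BWord)) (g : Equiv.Perm CantorC) : Prop :=
  IsCode J ∧ OrdPres J ∧ InducedBy J g

/-- Membership in (the realization on the Cantor space of) Thompson's group `F`. -/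
def InF (g : Equiv.Perm CantorC) : Prop := ∃ J, IsCodeFor J g

/-- The pair `(α, β)` has `|α| ≡ |β| (mod 2)`. -/
def EvenPair (p : BWord × BWord) : Prop := p.1.length % 2 = p.2.length % 2

/-- Membership in the subgroup `H₂` : some order-preserving code for `g` has all
pairs of even length difference. -/
def InH2 (g : Equiv.Perm CantorC) : Prop :=
  ∃ J, IsCodeFor J g ∧ ∀ p ∈ J, EvenPair p

/-- The union of the α-cylinders over pairs of even length difference. -/
def pSet (J : Finset (BWord × BWord)) : Set CantorC :=
  {x | ∃ p ∈ J, EvenPair p ∧ x ∈ cyl p.1}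

/-- The union of the β-cylinders over pairs of even length difference. -/
def eSet (J : Finset (BWord × BWord)) : Set CantorC :=
  {x | ∃ p ∈ J, EvenPair p ∧ x ∈ cyl p.2}

/-- `p_f` : for `f ∈ F` this equals `pSet J` for any (equivalently, every)
order-preserving code `J` for `f`. -/
def pF (g : Equiv.Perm CantorC) : Set CantorC :=
  ⋃ J ∈ {J : Finset (BWord × BWord) | IsCodeFor J g}, pSet J

/-- `E_f` : for `f ∈ F` this equals `eSet J` for any (equivalently, every)
order-preserving code `J` for `f`. -/
def EF (g : Equiv.Perm CantorC) : Set CantorC :=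
  ⋃ J ∈ {J : Finset (BWord × BWord) | IsCodeFor J g}, eSet J

/-- `Ω₂ = {p_f : f ∈ F}`. -/
def Omega2 : Set (Set CantorC) := {p | ∃ g, InF g ∧ pF g = p}

/-- The action `f · p = f(p ∩ E_f) ∪ f((C ∖ p) ∩ (C ∖ E_f))`. -/
def actF (g : Equiv.Perm CantorC) (p : Set CantorC) : Set CantorC :=
  g '' (p ∩ EF g) ∪ g '' (pᶜ ∩ (EF g)ᶜ)

open Classical in
/-- `T(p)` as a Boolean-valued characteristic function: `T(p) w = true` iff the
cylinder of `w` meets `p`. -/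
noncomputable def Tb (p : Set CantorC) : BWord → Bool :=
  fun w => if (cyl w ∩ p).Nonempty then true else false

/-- The embedding `p ↦ (T(p), T(C ∖ p))`. -/
noncomputable def embedT (p : Set CantorC) : (BWord → Bool) × (BWord → Bool) :=
  (Tb p, Tb pᶜ)

/-- `Ω̄₂` : the closure of the image of `Ω₂` under the embedding. -/
noncomputable def OmegaBar : Set ((BWord → Bool) × (BWord → Bool)) :=
  closure (embedT '' Omega2)

/-! ### Prepending words -/

lemma wordApp_nil (x : CantorC) : wordApp [] x = x := by
  funext n; simp [wordApp]

lemma wordApp_cons_zero (b : Bool) (w : BWord) (x : CantorC) : wordApp (b :: w) x 0 = b := by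
  simp [wordApp]

lemma wordApp_cons_succ (b : Bool) (w : BWord) (x : CantorC) (n : ℕ) :
    wordApp (b :: w) x (n + 1) = wordApp w x n := by
  simp [wordApp]

lemma wordApp_cons_eq_iff (b : Bool) (w : BWord) (x y : CantorC) :
    wordApp (b :: w) x = y ↔ y 0 = b ∧ wordApp w x = fun n => y (n + 1) := by
  constructor
  · rintro rfl
    exact ⟨wordApp_cons_zero b w x, funext fun n => (wordApp_cons_succ b w x n).symm⟩
  · rintro ⟨h0, h⟩
    funext n
    cases n with
    | zero => rw [wordApp_cons_zero, h0]
    | succ n => rw [wordApp_cons_succ, h]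

lemma wordApp_cons_inj (b c : Bool) (u v : BWord) (x y : CantorC) :
    wordApp (b :: u) x = wordApp (c :: v) y ↔ b = c ∧ wordApp u x = wordApp v y := by
  simp only [wordApp_cons_eq_iff, wordApp_cons_zero, wordApp_cons_succ, eq_comm (a := b)]

lemma wordApp_append (u v : BWord) (x : CantorC) :
    wordApp (u ++ v) x = wordApp u (wordApp v x) := by
  induction u with
  | nil => simp [wordApp_nil]
  | cons b u ih => simpa [wordApp_cons_inj] using ih

lemma wordApp_injective (w : BWord) : Function.Injective (wordApp w) := by
  intro x y h
  induction w with
  | nil => simpa [wordApp_nil] using h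
  | cons b w ih => exact ih ((wordApp_cons_inj _ _ _ _ _ _).1 h).2

lemma wordApp_eq_wordApp {u v : BWord} {x y : CantorC} (h : wordApp u x = wordApp v y) :
    (∃ s, v = u ++ s) ∨ ∃ s, u = v ++ s := by
  induction u generalizing v with
  | nil => exact Or.inl ⟨v, rfl⟩
  | cons b u ih =>
    cases v with
    | nil => exact Or.inr ⟨b :: u, rfl⟩
    | cons c v =>
      obtain ⟨rfl, huv⟩ := (wordApp_cons_inj _ _ _ _ _ _).1 h
      rcases ih huv with ⟨s, rfl⟩ | ⟨s, rfl⟩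
      · exact Or.inl ⟨s, rfl⟩
      · exact Or.inr ⟨s, rfl⟩

lemma eq_nil_of_forall_wordApp_eq {s : BWord} (h : ∀ x, wordApp s x = x) : s = [] := by
  cases s with
  | nil => rfl
  | cons b s =>
    have := congrFun (h fun _ => !b) 0
    rw [wordApp_cons_zero] at this
    simp at this

lemma eq_of_forall_wordApp_eq {u v : BWord} (h : ∀ x, wordApp u x = wordApp v x) : u = v := by
  rcases wordApp_eq_wordApp (h fun _ => false) with ⟨s, rfl⟩ | ⟨s, rfl⟩
  · have := eq_nil_of_forall_wordApp_eq (s := s) fun x =>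
      wordApp_injective u (by rw [← wordApp_append, h])
    simp [this]
  · have := eq_nil_of_forall_wordApp_eq (s := s) fun x =>
      wordApp_injective v (by rw [← wordApp_append, h])
    simp [this]

lemma mem_cyl_append_iff (w s : BWord) (x : CantorC) :
    x ∈ cyl (w ++ s) ↔ ∃ y ∈ cyl s, wordApp w y = x := by
  simp [cyl, wordApp_append]

/-! ### Codes: the induced bijection and the set `E_f` -/

lemma IsCode.exists_inducedBy {K : Finset (BWord × BWord)} (hK : IsCode K) :
    ∃ g : Equiv.Perm CantorC, InducedBy K g := by
  have hg : ∀ x, ∃ y, ∃ p ∈ K, ∃ z, wordApp p.2 z = x ∧ wordApp p.1 z = y := by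
    intro x
    obtain ⟨p, ⟨hp, z, hz⟩, -⟩ := hK.2 x
    exact ⟨_, p, hp, z, hz, rfl⟩
  have hh : ∀ y, ∃ x, ∃ p ∈ K, ∃ z, wordApp p.2 z = x ∧ wordApp p.1 z = y := by
    intro y
    obtain ⟨p, ⟨hp, z, hz⟩, -⟩ := hK.1 y
    exact ⟨_, p, hp, z, rfl, hz⟩
  choose g hg using hg
  choose h hh using hh
  have g_eq : ∀ p ∈ K, ∀ z, g (wordApp p.2 z) = wordApp p.1 z := by
    intro p hp z
    obtain ⟨q, hq, z', h1, h2⟩ := hg (wordApp p.2 z)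
    obtain rfl := (hK.2 (wordApp p.2 z)).unique ⟨hp, z, rfl⟩ ⟨hq, z', h1⟩
    rw [← h2, wordApp_injective _ h1]
  have h_eq : ∀ p ∈ K, ∀ z, h (wordApp p.1 z) = wordApp p.2 z := by
    intro p hp z
    obtain ⟨q, hq, z', h1, h2⟩ := hh (wordApp p.1 z)
    obtain rfl := (hK.1 (wordApp p.1 z)).unique ⟨hp, z, rfl⟩ ⟨hq, z', h2⟩
    rw [← h1, wordApp_injective _ h2]
  refine ⟨⟨g, h, fun x => ?_, fun y => ?_⟩, g_eq⟩
  · obtain ⟨p, hp, z, rfl, h2⟩ := hg x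
    rw [← h2, h_eq p hp]
  · obtain ⟨p, hp, z, h1, rfl⟩ := hh y
    rw [← h1, g_eq p hp]

lemma InducedBy.append_eq {K K' : Finset (BWord × BWord)} {g : Equiv.Perm CantorC}
    (hK : InducedBy K g) (hK' : InducedBy K' g) {p q : BWord × BWord} (hp : p ∈ K) (hq : q ∈ K')
    {s : BWord} (h : q.2 = p.2 ++ s) : q.1 = p.1 ++ s := by
  refine eq_of_forall_wordApp_eq fun x => ?_
  rw [← hK' q hq, h, wordApp_append, wordApp_append, hK p hp]

lemma InducedBy.evenPair_iff {K K' : Finset (BWord × BWord)} {g : Equiv.Perm CantorC}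
    (hK : InducedBy K g) (hK' : InducedBy K' g) {p q : BWord × BWord} (hp : p ∈ K) (hq : q ∈ K')
    {x : CantorC} (hxp : x ∈ cyl p.2) (hxq : x ∈ cyl q.2) : EvenPair p ↔ EvenPair q := by
  obtain ⟨y, rfl⟩ := hxp
  obtain ⟨z, hz⟩ := hxq
  unfold EvenPair
  rcases wordApp_eq_wordApp hz with ⟨s, hs⟩ | ⟨s, hs⟩
  · have := hK'.append_eq hK hq hp hs
    rw [hs, this, List.length_append, List.length_append]
    omega
  · have := hK.append_eq hK' hp hq hs
    rw [hs, this, List.length_append, List.length_append]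
    omega

lemma IsCodeFor.mem_EF_iff {K : Finset (BWord × BWord)} {g : Equiv.Perm CantorC}
    (hK : IsCodeFor K g) {p : BWord × BWord} (hp : p ∈ K) {x : CantorC} (hx : x ∈ cyl p.2) :
    x ∈ EF g ↔ EvenPair p := by
  simp only [EF, eSet, mem_iUnion, mem_ofPred_eq, exists_prop]
  constructor
  · rintro ⟨K', hK', q, hq, hev, hxq⟩
    exact (hK.2.2.evenPair_iff hK'.2.2 hp hq hx hxq).2 hev
  · exact fun hev => ⟨K, hK, p, hp, hev, hx⟩

/-! ### Labelled words -/

/-- The cylinder of `w` lies inside `P` or in its complement, and `c` records which of the two,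
twisted by the parity of the length of `w`. -/
def Labelled (P : Set CantorC) (w : BWord) (c : Bool) : Prop :=
  ∀ x ∈ cyl w, x ∈ P ↔ (c = true ↔ w.length % 2 = 0)

lemma Labelled.append_singleton {P : Set CantorC} {w : BWord} {c : Bool} (h : Labelled P w c)
    (b : Bool) : Labelled P (w ++ [b]) (!c) := by
  intro x hx
  obtain ⟨y, -, hy⟩ := (mem_cyl_append_iff _ _ _).1 hx
  rw [h x ⟨y, hy⟩]
  cases c <;> simp <;> omega

lemma IsCodeFor.actF_eq {K : Finset (BWord × BWord)} {g : Equiv.Perm CantorC}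
    (hK : IsCodeFor K g) {P Q : Set CantorC}
    (h : ∀ p ∈ K, ∃ c, Labelled P p.2 c ∧ Labelled Q p.1 c) : actF g P = Q := by
  ext y
  obtain ⟨x, rfl⟩ := g.surjective y
  obtain ⟨p, ⟨hp, hx⟩, -⟩ := hK.1.2 x
  obtain ⟨c, hP, hQ⟩ := h p hp
  have hgx : g x ∈ cyl p.1 := by
    obtain ⟨z, rfl⟩ := hx
    exact ⟨z, (hK.2.2 p hp z).symm⟩
  have hE := hK.mem_EF_iff hp hx
  have hxP := hP x hx
  have hxQ := hQ _ hgx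
  simp only [actF, mem_union, g.injective.mem_set_image, mem_inter_iff, mem_compl_iff, hE, hxP, hxQ,
    EvenPair]
  have h1 := Nat.mod_two_eq_zero_or_one p.1.length
  have h2 := Nat.mod_two_eq_zero_or_one p.2.length
  rcases h1 with h1 | h1 <;> rcases h2 with h2 | h2 <;> cases c <;> simp [h1, h2]

/-! ### Ordered partitions into cylinders -/

/-- `u` and `v` branch off from each other, `u` to the left and `v` to the right. -/
def BranchLT (u v : BWord) : Prop :=
  ∃ w s t, u = w ++ false :: s ∧ v = w ++ true :: t

lemma BranchLT.cons {u v : BWord} (h : BranchLT u v) (b : Bool) :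
    BranchLT (b :: u) (b :: v) := by
  obtain ⟨w, s, t, rfl, rfl⟩ := h
  exact ⟨b :: w, s, t, rfl, rfl⟩

lemma BranchLT.append {u v : BWord} (h : BranchLT u v) (s t : BWord) :
    BranchLT (u ++ s) (v ++ t) := by
  obtain ⟨w, s', t', rfl, rfl⟩ := h
  exact ⟨w, s' ++ s, t' ++ t, by simp, by simp⟩

lemma BranchLT.lt {u v : BWord} (h : BranchLT u v) : u < v := by
  obtain ⟨w, s, t, rfl, rfl⟩ := h
  exact List.Lex.append_left _ (List.Lex.rel (by decide)) w

lemma BranchLT.not_mem_cyl {u v : BWord} (h : BranchLT u v) {x : CantorC} (hu : x ∈ cyl u) :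
    x ∉ cyl v := by
  obtain ⟨w, s, t, rfl, rfl⟩ := h
  obtain ⟨y, rfl⟩ := hu
  rintro ⟨z, hz⟩
  rw [wordApp_append, wordApp_append] at hz
  simpa using ((wordApp_cons_inj _ _ _ _ _ _).1 (wordApp_injective w hz)).1

/-- The words of `L`, in this order, are the leaves of a finite binary tree. -/
def IsLeafList (L : List BWord) : Prop :=
  L.Pairwise BranchLT ∧ ∀ x, ∃ w ∈ L, x ∈ cyl w

lemma exists_inF_actF_eq {P Q : Set CantorC} {L M : List BWord} {cs : List Bool}
    (hL : IsLeafList L) (hM : IsLeafList M) (hLc : List.Forall₂ (Labelled P) L cs)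
    (hMc : List.Forall₂ (Labelled Q) M cs) : ∃ g, InF g ∧ actF g P = Q := by
  have hlen : M.length = L.length := hMc.length_eq.trans hLc.length_eq.symm
  set Z := M.zip L
  have h1 : Z.map Prod.fst = M := List.map_fst_zip hlen.le
  have h2 : Z.map Prod.snd = L := List.map_snd_zip hlen.ge
  have hZ : ∀ p ∈ Z, ∀ q ∈ Z, p = q ∨ (BranchLT p.1 q.1 ∧ BranchLT p.2 q.2) ∨
      (BranchLT q.1 p.1 ∧ BranchLT q.2 p.2) := by
    have hM1 := hM.1
    have hL1 := hL.1
    rw [← h1, List.pairwise_map] at hM1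
    rw [← h2, List.pairwise_map] at hL1
    have hZ := hM1.and hL1
    intro p hp q hq
    exact List.Pairwise.forall_of_forall_of_flip
      (R := fun p q : BWord × BWord => p = q ∨ (BranchLT p.1 q.1 ∧ BranchLT p.2 q.2) ∨
        (BranchLT q.1 p.1 ∧ BranchLT q.2 p.2)) (fun _ _ => Or.inl rfl)
      (hZ.imp fun h => Or.inr (Or.inl h)) (hZ.imp fun h => Or.inr (Or.inr h)) hp hq
  have hcode : IsCode Z.toFinset := by
    constructor
    · intro x
      obtain ⟨w, hw, hx⟩ := hM.2 x
      rw [← h1, List.mem_map] at hw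
      obtain ⟨p, hp, rfl⟩ := hw
      refine ⟨p, ⟨List.mem_toFinset.2 hp, hx⟩, ?_⟩
      rintro q ⟨hq, hxq⟩
      rcases hZ q (List.mem_toFinset.1 hq) p hp with h | h | h
      exacts [h, (h.1.not_mem_cyl hxq hx).elim, (h.1.not_mem_cyl hx hxq).elim]
    · intro x
      obtain ⟨w, hw, hx⟩ := hL.2 x
      rw [← h2, List.mem_map] at hw
      obtain ⟨p, hp, rfl⟩ := hw
      refine ⟨p, ⟨List.mem_toFinset.2 hp, hx⟩, ?_⟩
      rintro q ⟨hq, hxq⟩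
      rcases hZ q (List.mem_toFinset.1 hq) p hp with h | h | h
      exacts [h, (h.2.not_mem_cyl hxq hx).elim, (h.2.not_mem_cyl hx hxq).elim]
  have hord : OrdPres Z.toFinset := by
    intro p hp q hq
    change p.1 < q.1 ↔ p.2 < q.2
    rcases hZ p (List.mem_toFinset.1 hp) q (List.mem_toFinset.1 hq) with rfl | h | h
    · simp
    · exact iff_of_true h.1.lt h.2.lt
    · exact iff_of_false h.1.lt.asymm h.2.lt.asymm
  obtain ⟨g, hg⟩ := hcode.exists_inducedBy
  have hK : IsCodeFor Z.toFinset g := ⟨hcode, hord, hg⟩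
  refine ⟨g, ⟨_, hK⟩, hK.actF_eq fun p hp => ?_⟩
  obtain ⟨i, hi, rfl⟩ := List.getElem_of_mem (List.mem_toFinset.1 hp)
  have hi' : i < M.length ∧ i < L.length := by simpa [Z] using hi
  have hic : i < cs.length := hLc.length_eq ▸ hi'.2
  refine ⟨cs[i], ?_, ?_⟩
  · simpa [Z] using hLc.get hi'.2 hic
  · simpa [Z] using hMc.get hi'.1 hic

/-! ### Splitting a leaf -/

/-- Replace one entry `c` of a list by the two entries `f c`, `g c`. -/
inductive SplitStep {α : Type*} (f g : α → α) : List α → List α → Prop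
  | head (c : α) (l : List α) : SplitStep f g (c :: l) (f c :: g c :: l)
  | tail (c : α) {l l' : List α} : SplitStep f g l l' → SplitStep f g (c :: l) (c :: l')

/-- Replace one word by its two one-letter extensions. -/
abbrev WordSplit : List BWord → List BWord → Prop := SplitStep (· ++ [false]) (· ++ [true])

/-- The effect of `WordSplit` on labels. -/
abbrev LabelSplit : List Bool → List Bool → Prop := SplitStep (!·) (!·)

lemma WordSplit.exists_prefix {L M : List BWord} (h : WordSplit L M) :
    ∀ v ∈ M, ∃ u ∈ L, ∃ s, v = u ++ s := by
  induction h with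
  | head c l =>
    intro v hv
    simp only [List.mem_cons] at hv
    rcases hv with rfl | rfl | hv
    · exact ⟨c, by simp, _, rfl⟩
    · exact ⟨c, by simp, _, rfl⟩
    · exact ⟨v, by simp [hv], [], by simp⟩
  | tail c _ ih =>
    intro v hv
    rcases List.mem_cons.1 hv with rfl | hv
    · exact ⟨v, by simp, [], by simp⟩
    · obtain ⟨u, hu, hs⟩ := ih v hv
      exact ⟨u, by simp [hu], hs⟩

lemma WordSplit.pairwise {L M : List BWord} (h : WordSplit L M) (hL : L.Pairwise BranchLT) :
    M.Pairwise BranchLT := by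
  induction h with
  | head c l =>
    obtain ⟨h1, h2⟩ := List.pairwise_cons.1 hL
    have h3 : ∀ b, ∀ v ∈ l, BranchLT (c ++ [b]) v := fun b v hv => by
      simpa using (h1 v hv).append [b] []
    refine List.pairwise_cons.2 ⟨?_, List.pairwise_cons.2 ⟨h3 true, h2⟩⟩
    intro v hv
    rcases List.mem_cons.1 hv with rfl | hv
    · exact ⟨c, [], [], rfl, rfl⟩
    · exact h3 false v hv
  | tail c h ih =>
    obtain ⟨h1, h2⟩ := List.pairwise_cons.1 hL
    refine List.pairwise_cons.2 ⟨fun v hv => ?_, ih h2⟩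
    obtain ⟨u, hu, s, rfl⟩ := WordSplit.exists_prefix h v hv
    simpa using (h1 u hu).append [] s

lemma exists_mem_cyl_append_singleton {w : BWord} {x : CantorC} (hx : x ∈ cyl w) :
    ∃ b, x ∈ cyl (w ++ [b]) := by
  obtain ⟨y, rfl⟩ := hx
  exact ⟨y 0, (mem_cyl_append_iff _ _ _).2
    ⟨y, ⟨fun n => y (n + 1), by simp [wordApp_cons_eq_iff, wordApp_nil]⟩, rfl⟩⟩

lemma WordSplit.exists_mem_cyl {L M : List BWord} (h : WordSplit L M) {x : CantorC}
    (hx : ∃ w ∈ L, x ∈ cyl w) : ∃ w ∈ M, x ∈ cyl w := by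
  induction h with
  | head c l =>
    obtain ⟨w, hw, hx⟩ := hx
    rcases List.mem_cons.1 hw with rfl | hw
    · obtain ⟨b, hb⟩ := exists_mem_cyl_append_singleton hx
      exact ⟨_, by cases b <;> simp, hb⟩
    · exact ⟨w, by simp [hw], hx⟩
  | tail c _ ih =>
    obtain ⟨w, hw, hx⟩ := hx
    rcases List.mem_cons.1 hw with rfl | hw
    · exact ⟨w, by simp, hx⟩
    · obtain ⟨v, hv, hxv⟩ := ih ⟨w, hw, hx⟩
      exact ⟨v, by simp [hv], hxv⟩

lemma IsLeafList.wordSplit {L M : List BWord} (hL : IsLeafList L) (h : WordSplit L M) :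
    IsLeafList M :=
  ⟨h.pairwise hL.1, fun x => h.exists_mem_cyl (hL.2 x)⟩

lemma LabelSplit.exists_wordSplit {P : Set CantorC} {L : List BWord} {cs ds : List Bool}
    (h : LabelSplit cs ds) (hL : List.Forall₂ (Labelled P) L cs) :
    ∃ M, WordSplit L M ∧ List.Forall₂ (Labelled P) M ds := by
  induction h generalizing L with
  | head c l =>
    cases hL with
    | cons hc hl =>
      exact ⟨_, SplitStep.head _ _, .cons (hc.append_singleton _) (.cons (hc.append_singleton _) hl)⟩
  | tail c _ ih =>
    cases hL with
    | cons hc hl =>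
      obtain ⟨M, hM, hMd⟩ := ih hl
      exact ⟨_, SplitStep.tail _ hM, .cons hc hMd⟩

lemma exists_isLeafList_of_reflTransGen {P : Set CantorC} {L : List BWord} {cs ds : List Bool}
    (h : Relation.ReflTransGen LabelSplit cs ds) (hL : IsLeafList L)
    (hLc : List.Forall₂ (Labelled P) L cs) :
    ∃ M, IsLeafList M ∧ List.Forall₂ (Labelled P) M ds := by
  induction h with
  | refl => exact ⟨L, hL, hLc⟩
  | tail _ h ih =>
    obtain ⟨M, hM, hMc⟩ := ih
    obtain ⟨N, hN, hNd⟩ := LabelSplit.exists_wordSplit h hMc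
    exact ⟨N, hM.wordSplit hN, hNd⟩

/-! ### Lists of labels up to common refinement -/

lemma SplitStep.cons_reflTransGen {α : Type*} {f g : α → α} {l l' : List α} (c : α)
    (h : Relation.ReflTransGen (SplitStep f g) l l') :
    Relation.ReflTransGen (SplitStep f g) (c :: l) (c :: l') :=
  h.lift (c :: ·) fun _ _ => SplitStep.tail c

lemma SplitStep.diamond {α : Type*} {f g : α → α} {a b c : List α} (hb : SplitStep f g a b)
    (hc : SplitStep f g a c) :
    ∃ d, Relation.ReflGen (SplitStep f g) b d ∧ Relation.ReflTransGen (SplitStep f g) c d := by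
  induction hb generalizing c with
  | head x l =>
    cases hc with
    | head => exact ⟨_, .refl, .refl⟩
    | tail _ h => exact ⟨_, .single (.tail _ (.tail _ h)), .single (.head _ _)⟩
  | tail x h ih =>
    cases hc with
    | head => exact ⟨_, .single (.head _ _), .single (.tail _ (.tail _ h))⟩
    | tail _ h' =>
      obtain ⟨d, h1, h2⟩ := ih h'
      refine ⟨x :: d, ?_, SplitStep.cons_reflTransGen x h2⟩
      cases h1 with
      | refl => exact .refl
      | single h1 => exact .single (.tail _ h1)

/-- Two lists of labels have a common refinement. -/
abbrev LabelJoin : List Bool → List Bool → Prop := Relation.Join (Relation.ReflTransGen LabelSplit)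

lemma labelJoin_equivalence : Equivalence LabelJoin :=
  Relation.equivalence_join_reflTransGen fun _ _ _ => SplitStep.diamond

lemma LabelSplit.join {l l' : List Bool} (h : LabelSplit l l') : LabelJoin l l' :=
  ⟨l', .single h, .refl⟩

lemma LabelJoin.cons {l l' : List Bool} (h : LabelJoin l l') (c : Bool) :
    LabelJoin (c :: l) (c :: l') := by
  obtain ⟨d, h1, h2⟩ := h
  exact ⟨c :: d, SplitStep.cons_reflTransGen c h1, SplitStep.cons_reflTransGen c h2⟩

/-- The number of labels `true` in the refinement that splits every label `false`. -/
def labelWeight (cs : List Bool) : ℕ := cs.length + cs.count false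

lemma labelJoin_replicate (cs : List Bool) :
    LabelJoin cs (List.replicate (labelWeight cs) true) := by
  induction cs with
  | nil => exact labelJoin_equivalence.refl _
  | cons c cs ih =>
    cases c with
    | true =>
      have : labelWeight (true :: cs) = labelWeight cs + 1 := by simp [labelWeight]; omega
      rw [this]
      exact ih.cons true
    | false =>
      have : labelWeight (false :: cs) = labelWeight cs + 1 + 1 := by simp [labelWeight]; omega
      rw [this]
      exact labelJoin_equivalence.trans (LabelSplit.join (.head false cs)) ((ih.cons true).cons true)

lemma labelJoin_replicate_add_three (k : ℕ) :
    LabelJoin (List.replicate (k + 1) true) (List.replicate (k + 4) true) :=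
  labelJoin_equivalence.trans (LabelSplit.join (.head true (List.replicate k true)))
    (by
      have h := labelJoin_replicate (false :: false :: List.replicate k true)
      have h' : labelWeight (false :: false :: List.replicate k true) = k + 4 := by
        simp [labelWeight, List.count_replicate]
      rwa [h'] at h)

lemma labelJoin_of_labelWeight_eq_add_three {cs ds : List Bool} (hds : ds ≠ [])
    (h : labelWeight cs = labelWeight ds + 3) : LabelJoin cs ds := by
  have hpos : 0 < labelWeight ds := by
    have := List.length_pos_iff.2 hds
    unfold labelWeight; omega
  obtain ⟨k, hk⟩ := Nat.exists_eq_succ_of_ne_zero hpos.ne'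
  have h1 := labelJoin_replicate cs
  have h2 := labelJoin_replicate ds
  rw [h, hk] at h1
  rw [hk] at h2
  exact labelJoin_equivalence.trans h1 (labelJoin_equivalence.trans
    (labelJoin_equivalence.symm (labelJoin_replicate_add_three k)) (labelJoin_equivalence.symm h2))

/-! ### The words of a given length -/

/-- All words of length `n` in lexicographic order. -/
def wordsOfLength : ℕ → List BWord
  | 0 => [[]]
  | n + 1 => (wordsOfLength n).map (false :: ·) ++ (wordsOfLength n).map (true :: ·)

lemma mem_wordsOfLength {n : ℕ} {w : BWord} : w ∈ wordsOfLength n ↔ w.length = n := by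
  induction n generalizing w with
  | zero => simp [wordsOfLength]
  | succ n ih =>
    cases w with
    | nil => simp [wordsOfLength]
    | cons b w => cases b <;> simp [wordsOfLength, ih]

lemma isLeafList_wordsOfLength (n : ℕ) : IsLeafList (wordsOfLength n) := by
  constructor
  · induction n with
    | zero => simp [wordsOfLength]
    | succ n ih =>
      refine List.pairwise_append.2 ⟨?_, ?_, ?_⟩
      · exact List.pairwise_map.2 (ih.imp fun h => h.cons false)
      · exact List.pairwise_map.2 (ih.imp fun h => h.cons true)
      · simp only [List.mem_map]
        rintro _ ⟨u, -, rfl⟩ _ ⟨v, -, rfl⟩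
        exact ⟨[], u, v, rfl, rfl⟩
  · intro x
    induction n with
    | zero => exact ⟨[], by simp [wordsOfLength], x, wordApp_nil x⟩
    | succ n ih =>
      obtain ⟨w, hw, hx⟩ := ih
      obtain ⟨b, hb⟩ := exists_mem_cyl_append_singleton hx
      exact ⟨_, mem_wordsOfLength.2 (by simp [mem_wordsOfLength.1 hw]), hb⟩

lemma eq_of_mem_cyl_of_length_eq {u v : BWord} {x : CantorC} (hu : x ∈ cyl u) (hv : x ∈ cyl v)
    (h : u.length = v.length) : u = v := by
  obtain ⟨y, rfl⟩ := hu
  obtain ⟨z, hz⟩ := hv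
  rcases wordApp_eq_wordApp hz with ⟨s, rfl⟩ | ⟨s, rfl⟩ <;> simp_all

lemma labelled_iUnion_cyl {m : ℕ} {J : Finset BWord} (hJ : ∀ w ∈ J, w.length = 2 * m + 1)
    {w : BWord} (hw : w.length = 2 * m + 1) :
    Labelled (⋃ w ∈ J, cyl w) w (decide (w ∉ J)) := by
  intro x hx
  have hmem : x ∈ (⋃ w ∈ J, cyl w) ↔ w ∈ J := by
    simp only [mem_iUnion, exists_prop]
    constructor
    · rintro ⟨v, hv, hxv⟩
      rwa [eq_of_mem_cyl_of_length_eq hx hxv (hw.trans (hJ v hv).symm)]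
    · exact fun h => ⟨w, h, hx⟩
  have : w.length % 2 = 1 := by omega
  simp [hmem, this]

lemma labelWeight_map_not_mem {n : ℕ} {J : Finset BWord} (hJ : ∀ w ∈ J, w.length = n) :
    labelWeight ((wordsOfLength n).map fun w => decide (w ∉ J)) =
      (wordsOfLength n).length + J.card := by
  have hnd : (wordsOfLength n).Nodup :=
    (isLeafList_wordsOfLength n).1.imp fun h => h.lt.ne
  have hJ' : ((wordsOfLength n).filter (· ∈ J)).toFinset = J := by
    ext w
    simp only [List.mem_toFinset, List.mem_filter, mem_wordsOfLength, decide_eq_true_eq]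
    exact ⟨And.right, fun h => ⟨hJ w h, h⟩⟩
  rw [labelWeight, List.length_map, ← hJ', List.toFinset_card_of_nodup (hnd.filter _), hJ',
    List.count, List.countP_map, List.countP_eq_length_filter]
  congr 3
  funext w
  simp

lemma forall₂_labelled_wordsOfLength {m : ℕ} {J : Finset BWord}
    (hJ : ∀ w ∈ J, w.length = 2 * m + 1) :
    List.Forall₂ (Labelled (⋃ w ∈ J, cyl w)) (wordsOfLength (2 * m + 1))
      ((wordsOfLength (2 * m + 1)).map fun w => decide (w ∉ J)) := by
  rw [List.forall₂_map_right_iff, List.forall₂_same]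
  exact fun w hw => labelled_iUnion_cyl hJ (mem_wordsOfLength.1 hw)

/-- if `J` is a set of words of length `2m+1` with at least `5`
elements and `α₁ ≺ α₂ ≺ α₃` are elements of `J`, then some `f ∈ F` maps
`⋃_{α ∈ J} C_α` to `⋃_{α ∈ J ∖ {α₁,α₂,α₃}} C_α` under the action. -/
theorem stmt12 (m : ℕ) (J : Finset BWord) (hlen : ∀ w ∈ J, w.length = 2 * m + 1)
    (hcard : 5 ≤ J.card) (a₁ a₂ a₃ : BWord)
    (h1 : a₁ ∈ J) (h2 : a₂ ∈ J) (h3 : a₃ ∈ J)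
    (h12 : List.Lex (· < ·) a₁ a₂) (h23 : List.Lex (· < ·) a₂ a₃) :
    ∃ f : Equiv.Perm CantorC, InF f ∧
      actF f (⋃ w ∈ J, cyl w) = ⋃ w ∈ (J \ {a₁, a₂, a₃} : Finset BWord), cyl w := by
  classical
  have hJ' : ∀ w ∈ J \ {a₁, a₂, a₃}, w.length = 2 * m + 1 :=
    fun w hw => hlen w (Finset.mem_sdiff.1 hw).1
  have hsub : ({a₁, a₂, a₃} : Finset BWord) ⊆ J := by
    simp [Finset.insert_subset_iff, h1, h2, h3]
  have hthree : ({a₁, a₂, a₃} : Finset BWord).card = 3 := by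
    have h12' : a₁ < a₂ := h12
    have h23' : a₂ < a₃ := h23
    exact Finset.card_eq_three.2 ⟨a₁, a₂, a₃, h12'.ne, (h12'.trans h23').ne, h23'.ne, rfl⟩
  have hcards := Finset.card_sdiff_add_card_eq_card hsub
  have hne : (wordsOfLength (2 * m + 1)).map (fun w => decide (w ∉ J \ {a₁, a₂, a₃})) ≠ [] := by
    rw [Ne, List.map_eq_nil_iff]
    exact List.ne_nil_of_mem (mem_wordsOfLength.2 (hlen a₁ h1))
  obtain ⟨e, hP, hQ⟩ := labelJoin_of_labelWeight_eq_add_three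
    (cs := (wordsOfLength (2 * m + 1)).map fun w => decide (w ∉ J)) hne
    (by rw [labelWeight_map_not_mem hlen, labelWeight_map_not_mem hJ']; omega)
  have hleaf := isLeafList_wordsOfLength (2 * m + 1)
  obtain ⟨L, hL, hLe⟩ := exists_isLeafList_of_reflTransGen hP hleaf
    (forall₂_labelled_wordsOfLength hlen)
  obtain ⟨M, hM, hMe⟩ := exists_isLeafList_of_reflTransGen hQ hleaf
    (forall₂_labelled_wordsOfLength hJ')
  exact exists_inF_actF_eq hL hM hLe hMe
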